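/- arXiv:2605.22014 — 2 statements merged into one kernel-verified Lean document; each statement's English description precedes it below -/
import Mathlib

section
/- Let N, p, q be natural numbers with p > 0, p ∣ q and q ∣ N, and set m = q / p. For every source rank k < p, the source block Set.Ico (k * (N / p)) ((k + 1) * (N / p)) of the equal-block sharding into p parts equals the union, over the m destination ranks j with k * m ≤ j < (k + 1) * m, of the destination blocks Set.Ico (j * (N / q)) ((j + 1) * (N / q)) of the equal-block sharding into q parts; moreover these m destination blocks are pairwise disjoint. (Each source shard splits exactly into q/p consecutive destination shards, so the equal-block sharding into q parts refines the one into p parts.) -/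
/-- Each source shard of the equal-block sharding into `p` parts splits exactly
into the `m = q / p` consecutive destination shards of the sharding into `q`
parts, and these destination shards are pairwise disjoint. -/
theorem src_block_eq_union_dest_blocks (N p q : ℕ) (hp : 0 < p) (hpq : p ∣ q)
    (hqN : q ∣ N) (m : ℕ) (hm : m = q / p) :
    ∀ k < p,
      (Set.Ico (k * (N / p)) ((k + 1) * (N / p)) =
        ⋃ j ∈ Finset.Ico (k * m) ((k + 1) * m),
          Set.Ico (j * (N / q)) ((j + 1) * (N / q))) ∧
      (∀ j₁ j₂, k * m ≤ j₁ → j₁ < (k + 1) * m → k * m ≤ j₂ → j₂ < (k + 1) * m →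
        j₁ ≠ j₂ →
        Disjoint (Set.Ico (j₁ * (N / q)) ((j₁ + 1) * (N / q)))
                 (Set.Ico (j₂ * (N / q)) ((j₂ + 1) * (N / q)))) := by
  intro k _
  have hN : N / p = m * (N / q) := by
    obtain ⟨c, rfl⟩ := hpq
    obtain ⟨b, rfl⟩ := hqN
    rw [Nat.mul_div_cancel_left c hp] at hm
    subst hm
    rw [mul_assoc, Nat.mul_div_cancel_left _ hp, ← mul_assoc]
    rcases Nat.eq_zero_or_pos m with h | h
    · simp [h]
    · rw [Nat.mul_div_cancel_left b (Nat.mul_pos hp h)]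
  rw [hN]
  generalize N / q = b
  constructor
  · ext x
    simp only [Set.mem_iUnion, Set.mem_Ico, Finset.mem_Ico, exists_prop, ← mul_assoc]
    constructor
    · rintro ⟨h1, h2⟩
      have hb : 0 < b := by
        rcases Nat.eq_zero_or_pos b with h | h
        · simp [h] at h2
        · exact h
      refine ⟨x / b, ⟨(Nat.le_div_iff_mul_le hb).2 h1, (Nat.div_lt_iff_lt_mul hb).2 h2⟩,
        Nat.div_mul_le_self x b, ?_⟩
      exact (Nat.div_lt_iff_lt_mul hb).1 (Nat.lt_succ_self _)
    · rintro ⟨j, ⟨h1, h2⟩, h3, h4⟩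
      exact ⟨(Nat.mul_le_mul_right b h1).trans h3,
        h4.trans_le (Nat.mul_le_mul_right b h2)⟩
  · intro j₁ j₂ _ _ _ _ hne
    rw [Set.disjoint_left]
    rintro x ⟨h1, h2⟩ ⟨h3, h4⟩
    have a1 := Nat.lt_of_mul_lt_mul_right (h1.trans_lt h4)
    have a2 := Nat.lt_of_mul_lt_mul_right (h3.trans_lt h2)
    omega
end

section
/- Let N, p, q be natural numbers with N > 0, and let a : Fin (p + 1) → ℕ and b : Fin (q + 1) → ℕ be strictly monotone breakpoint sequences with a 0 = 0, a p = N, b 0 = 0, b q = N, defining interval partitions of [0, N) into p and q consecutive parts respectively. Then the number of pairs (k, j) with k < p, j < q for which Set.Ico (a k) (a (k+1)) ∩ Set.Ico (b j) (b (j+1)) is nonempty is at most p + q - 1. (The transfer plan between two one-dimensional interval partitions contains at most p + q - 1 transfer tasks, so the plan size is linear in the number of ranks.) -/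
/-- The transfer plan between two one-dimensional interval partitions of
`[0, N)` into `p` and `q` consecutive parts contains at most `p + q - 1`
transfer tasks (pairs of parts with nonempty intersection). -/
theorem transfer_plan_size_upper_bound (N p q : ℕ) (hN : 0 < N)
    (a : Fin (p + 1) → ℕ) (b : Fin (q + 1) → ℕ)
    (ha : StrictMono a) (hb : StrictMono b)
    (ha0 : a 0 = 0) (haN : a (Fin.last p) = N)
    (hb0 : b 0 = 0) (hbN : b (Fin.last q) = N) :
    {kj : Fin p × Fin q |
      (Set.Ico (a kj.1.castSucc) (a kj.1.succ) ∩
        Set.Ico (b kj.2.castSucc) (b kj.2.succ)).Nonempty}.ncard ≤ p + q - 1 := by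
  have key : ∀ (k k' : Fin p) (j j' : Fin q) (x y : ℕ), k < k' → j' < j →
      x < a k.succ → a k'.castSucc ≤ y → y < b j'.succ → b j.castSucc ≤ x → False := by
    intro k k' j j' x y hk hj h1 h2 h3 h4
    have e1 : a k.succ ≤ a k'.castSucc := ha.monotone (by
      rw [Fin.le_def, Fin.val_succ, Fin.val_castSucc]; exact hk)
    have e2 : b j'.succ ≤ b j.castSucc := hb.monotone (by
      rw [Fin.le_def, Fin.val_succ, Fin.val_castSucc]; exact hj)
    omega
  have h := Set.ncard_le_ncard_of_injOn
    (s := {kj : Fin p × Fin q |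
      (Set.Ico (a kj.1.castSucc) (a kj.1.succ) ∩
        Set.Ico (b kj.2.castSucc) (b kj.2.succ)).Nonempty})
    (t := ((Finset.range (p + q - 1) : Finset ℕ) : Set ℕ))
    (fun kj => (kj.1 : ℕ) + (kj.2 : ℕ)) ?_ ?_ (Finset.finite_toSet _)
  · rwa [Set.ncard_coe_finset, Finset.card_range] at h
  · rintro ⟨k, j⟩ _
    have := k.2
    have := j.2
    simp only [Finset.coe_range, Set.mem_Iio]
    omega
  · rintro ⟨k, j⟩ ⟨x, ⟨hx1, hx2⟩, hx3, hx4⟩ ⟨k', j'⟩ ⟨y, ⟨hy1, hy2⟩, hy3, hy4⟩ hs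
    simp only at hs hx1 hx2 hx3 hx4 hy1 hy2 hy3 hy4
    rcases lt_trichotomy (k : ℕ) k' with hlt | heq | hgt
    · exact (key k k' j j' x y hlt (Fin.lt_def.2 (by omega)) hx2 hy1 hy4 hx3).elim
    · exact Prod.ext (Fin.ext heq) (Fin.ext (by simp only; omega))
    · exact (key k' k j' j y x hgt (Fin.lt_def.2 (by omega)) hy2 hx1 hx4 hy3).elim
end
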